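/- arXiv:hep-th/0009145 — 7 statements merged into one kernel-verified Lean document; each statement's English description precedes it below -/
import Mathlib

section
/- Second law for nonpositive kinetic potential (Proposition 1): Suppose U : D → ℝ is C², V : D → ℝ is continuous with V(z) ≤ 0 for all z ∈ D, Φ : ℝ → D is C², the null energy condition holds, i.e. T(τ) := (V(Φ(τ)) − U''(Φ(τ)))·Φ'(τ)² − U'(Φ(τ))·Φ''(τ) ≥ 0 for all τ ∈ ℝ, and the late-time condition S'(τ) → 0 as τ → +∞ holds, where S := U ∘ Φ. Then S'(τ) ≥ 0 for all τ ∈ ℝ. -/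
/-- **Proposition 1** (second law for nonpositive kinetic potential).
`D ⊆ ℝ` is an open interval, `U : D → ℝ` is `C²`, `V : D → ℝ` is continuous and
nonpositive, `Φ : ℝ → D` is `C²`.  If the null energy condition
`0 ≤ (V(Φ τ) - U''(Φ τ))·Φ'(τ)² - U'(Φ τ)·Φ''(τ)` holds for all `τ` and the
late-time condition `S'(τ) → 0` as `τ → ∞` holds for the entropy `S := U ∘ Φ`,
then `S'(τ) ≥ 0` for all `τ`. -/
theorem second_law_nonpositive_V
    (D : Set ℝ) (hDopen : IsOpen D) (hDconn : D.OrdConnected)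
    (U V Φ : ℝ → ℝ)
    (hU : ContDiffOn ℝ 2 U D)
    (hV : ContinuousOn V D) (hVneg : ∀ z ∈ D, V z ≤ 0)
    (hΦD : ∀ τ : ℝ, Φ τ ∈ D) (hΦ : ContDiff ℝ 2 Φ)
    (hNEC : ∀ τ : ℝ,
      0 ≤ (V (Φ τ) - deriv (deriv U) (Φ τ)) * (deriv Φ τ) ^ 2
            - deriv U (Φ τ) * deriv (deriv Φ) τ)
    (hlate : Filter.Tendsto (deriv (U ∘ Φ)) Filter.atTop (nhds 0)) :
    ∀ τ : ℝ, 0 ≤ deriv (U ∘ Φ) τ := by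
  have hU1 : ∀ z ∈ D, HasDerivAt U (deriv U z) z := fun z hz =>
    ((hU.differentiableOn (by norm_num)).differentiableAt (hDopen.mem_nhds hz)).hasDerivAt
  have hU2 : ∀ z ∈ D, HasDerivAt (deriv U) (deriv (deriv U) z) z := fun z hz =>
    (((hU.deriv_of_isOpen (m := 1) hDopen (by norm_num)).differentiableOn
      (by norm_num)).differentiableAt (hDopen.mem_nhds hz)).hasDerivAt
  have hΦ1 : ∀ τ, HasDerivAt Φ (deriv Φ τ) τ := fun τ =>
    (hΦ.differentiable (by norm_num) τ).hasDerivAt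
  have hΦ2 : ∀ τ, HasDerivAt (deriv Φ) (deriv (deriv Φ) τ) τ := fun τ =>
    ((ContDiff.deriv' (n := 1) (by simpa [one_add_one_eq_two] using hΦ)).differentiable
      (by norm_num) τ).hasDerivAt
  have hS : deriv (U ∘ Φ) = fun τ => deriv U (Φ τ) * deriv Φ τ :=
    funext fun τ => ((hU1 _ (hΦD τ)).comp τ (hΦ1 τ)).deriv
  have hS' : ∀ τ, HasDerivAt (deriv (U ∘ Φ))
      (deriv (deriv U) (Φ τ) * deriv Φ τ * deriv Φ τ + deriv U (Φ τ) * deriv (deriv Φ) τ) τ := by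
    intro τ
    rw [hS]
    exact ((hU2 _ (hΦD τ)).comp τ (hΦ1 τ)).mul (hΦ2 τ)
  have hanti : Antitone (deriv (U ∘ Φ)) := by
    refine antitone_of_deriv_nonpos (fun τ => (hS' τ).differentiableAt) fun τ => ?_
    rw [(hS' τ).deriv]
    nlinarith [hNEC τ, mul_nonneg (neg_nonneg.2 (hVneg _ (hΦD τ))) (sq_nonneg (deriv Φ τ))]
  exact hanti.le_of_tendsto hlate
end

section
/- Second law for monotonic U with V − U'' nonpositive (Proposition 2): Suppose U : D → ℝ is C² with U'(z) ≠ 0 for all z ∈ D (so U is strictly monotonic), V : D → ℝ is continuous with V(z) − U''(z) ≤ 0 for all z ∈ D, Φ : ℝ → D is C², the null energy condition T(τ) := (V(Φ(τ)) − U''(Φ(τ)))·Φ'(τ)² − U'(Φ(τ))·Φ''(τ) ≥ 0 holds for all τ ∈ ℝ, and Φ'(τ) → 0 as τ → +∞. Then S'(τ) ≥ 0 for all τ ∈ ℝ, where S := U ∘ Φ. -/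
/-- **Proposition 2** (second law for monotonic `U` with `V - U''` nonpositive).
`D ⊆ ℝ` is an open interval, `U : D → ℝ` is `C²` with nonvanishing derivative,
`V : D → ℝ` is continuous with `V - U'' ≤ 0` on `D`, and `Φ : ℝ → D` is `C²`.
If the null energy condition holds and `Φ'(τ) → 0` as `τ → ∞`, then the entropy
`S := U ∘ Φ` satisfies `S'(τ) ≥ 0` for all `τ`. -/
theorem second_law_monotonic_U
    (D : Set ℝ) (hDopen : IsOpen D) (hDconn : D.OrdConnected)
    (U V Φ : ℝ → ℝ)
    (hU : ContDiffOn ℝ 2 U D) (hU' : ∀ z ∈ D, deriv U z ≠ 0)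
    (hV : ContinuousOn V D)
    (hVU'' : ∀ z ∈ D, V z - deriv (deriv U) z ≤ 0)
    (hΦD : ∀ τ : ℝ, Φ τ ∈ D) (hΦ : ContDiff ℝ 2 Φ)
    (hNEC : ∀ τ : ℝ,
      0 ≤ (V (Φ τ) - deriv (deriv U) (Φ τ)) * (deriv Φ τ) ^ 2
            - deriv U (Φ τ) * deriv (deriv Φ) τ)
    (hlate : Filter.Tendsto (deriv Φ) Filter.atTop (nhds 0)) :
    ∀ τ : ℝ, 0 ≤ deriv (U ∘ Φ) τ := by
  have hUd : ∀ z ∈ D, DifferentiableAt ℝ U z := fun z hz =>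
    (hU.differentiableOn (by norm_num)).differentiableAt (hDopen.mem_nhds hz)
  have hΦd : Differentiable ℝ Φ := hΦ.differentiable (by norm_num)
  have hΦ'd : Differentiable ℝ (deriv Φ) :=
    (contDiff_succ_iff_deriv.1 (show ContDiff ℝ (1 + 1) Φ by simpa [one_add_one_eq_two] using hΦ)).2.2
      |>.differentiable (by norm_num)
  have hsign : ∀ τ, deriv U (Φ τ) * deriv (deriv Φ) τ ≤ 0 := fun τ => by
    have := mul_nonpos_of_nonpos_of_nonneg (hVU'' _ (hΦD τ)) (sq_nonneg (deriv Φ τ))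
    linarith [hNEC τ]
  intro τ
  rw [deriv_comp τ (hUd _ (hΦD τ)) (hΦd τ)]
  rcases hasDerivWithinAt_forall_lt_or_forall_gt_of_forall_ne hDconn.convex
    (fun z hz => (hUd z hz).hasDerivAt.hasDerivWithinAt) hU' with hneg | hpos
  · have hmono : Monotone (deriv Φ) := monotone_of_deriv_nonneg hΦ'd fun t =>
      nonneg_of_mul_nonpos_right (hsign t) (hneg _ (hΦD t))
    exact mul_nonneg_of_nonpos_of_nonpos (hneg _ (hΦD τ)).le (hmono.ge_of_tendsto hlate τ)
  · have hanti : Antitone (deriv Φ) := antitone_of_deriv_nonpos hΦ'd fun t =>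
      nonpos_of_mul_nonpos_right (hsign t) (hpos _ (hΦD t))
    exact mul_nonneg (hpos _ (hΦD τ)).le (hanti.le_of_tendsto hlate τ)
end

section
/- Second law for U without critical points (Proposition 3): Suppose U : D → ℝ is C² with U'(z) ≠ 0 for all z ∈ D, V : D → ℝ is continuous, Φ : ℝ → D is C², the null energy condition T(τ) := (V(Φ(τ)) − U''(Φ(τ)))·Φ'(τ)² − U'(Φ(τ))·Φ''(τ) ≥ 0 holds for all τ ∈ ℝ, and the late-time condition S'(τ)/F₀(Φ(τ)) → 0 as τ → +∞ holds, where S := U ∘ Φ. Then S'(τ) ≥ 0 for all τ ∈ ℝ. -/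
/-- The primitive of a function continuous on an open interval `D` has the expected derivative
at every point of `D`. -/
lemma hasDerivAt_integral_of_continuousOn_ordConnected {D : Set ℝ} (hD : IsOpen D)
    (hconn : D.OrdConnected) {f : ℝ → ℝ} (hf : ContinuousOn f D) {a b : ℝ} (ha : a ∈ D)
    (hb : b ∈ D) : HasDerivAt (fun x => ∫ z in a..x, f z) (f b) b :=
  intervalIntegral.integral_hasDerivAt_right
    ((hf.mono (hconn.uIcc_subset ha hb)).intervalIntegrable)
    (hf.stronglyMeasurableAtFilter hD b hb)
    (hf.continuousAt (hD.mem_nhds hb))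

/-- **Proposition 3** (second law for `U` without critical points).
`D ⊆ ℝ` is an open interval, `U : D → ℝ` is `C²` with `U' ≠ 0` on `D`,
`V : D → ℝ` is continuous, `Φ : ℝ → D` is `C²`.  With
`F₀(Z) := exp (∫_{z₀}^{Z} V(z)/U'(z) dz)` for a fixed base point `z₀ ∈ D`,
if the null energy condition holds and `S'(τ)/F₀(Φ(τ)) → 0` as `τ → ∞`
for the entropy `S := U ∘ Φ`, then `S'(τ) ≥ 0` for all `τ`. -/
theorem second_law_U_no_critical_points
    (D : Set ℝ) (hDopen : IsOpen D) (hDconn : D.OrdConnected)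
    (U V Φ : ℝ → ℝ)
    (hU : ContDiffOn ℝ 2 U D) (hU' : ∀ z ∈ D, deriv U z ≠ 0)
    (hV : ContinuousOn V D)
    (hΦD : ∀ τ : ℝ, Φ τ ∈ D) (hΦ : ContDiff ℝ 2 Φ)
    (hNEC : ∀ τ : ℝ,
      0 ≤ (V (Φ τ) - deriv (deriv U) (Φ τ)) * (deriv Φ τ) ^ 2
            - deriv U (Φ τ) * deriv (deriv Φ) τ)
    (z₀ : ℝ) (hz₀ : z₀ ∈ D)
    (F₀ : ℝ → ℝ) (hF₀ : ∀ Z ∈ D, F₀ Z = Real.exp (∫ z in z₀..Z, V z / deriv U z))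
    (hlate : Filter.Tendsto (fun τ => deriv (U ∘ Φ) τ / F₀ (Φ τ))
      Filter.atTop (nhds 0)) :
    ∀ τ : ℝ, 0 ≤ deriv (U ∘ Φ) τ := by
  have hdU : ContDiffOn ℝ 1 (deriv U) D :=
    ((contDiffOn_succ_iff_deriv_of_isOpen (n := 1) hDopen).1 hU).2.2
  have hdΦ : ContDiff ℝ 1 (deriv Φ) :=
    ((contDiff_succ_iff_deriv (n := 1)).1 hΦ).2.2
  have hU1 : ∀ z ∈ D, HasDerivAt U (deriv U z) z := fun z hz =>
    ((hU.differentiableOn (by norm_num)).differentiableAt (hDopen.mem_nhds hz)).hasDerivAt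
  have hU2 : ∀ z ∈ D, HasDerivAt (deriv U) (deriv (deriv U) z) z := fun z hz =>
    ((hdU.differentiableOn (by norm_num)).differentiableAt (hDopen.mem_nhds hz)).hasDerivAt
  have hΦ1 : ∀ τ, HasDerivAt Φ (deriv Φ τ) τ := fun τ =>
    (hΦ.differentiable (by norm_num) τ).hasDerivAt
  have hΦ2 : ∀ τ, HasDerivAt (deriv Φ) (deriv (deriv Φ) τ) τ := fun τ =>
    (hdΦ.differentiable (by norm_num) τ).hasDerivAt
  have hS : ∀ τ, deriv (U ∘ Φ) τ = deriv U (Φ τ) * deriv Φ τ := fun τ =>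
    ((hU1 _ (hΦD τ)).comp τ (hΦ1 τ)).deriv
  have hI : ∀ τ, HasDerivAt (fun τ => ∫ z in z₀..Φ τ, V z / deriv U z)
      (V (Φ τ) / deriv U (Φ τ) * deriv Φ τ) τ := fun τ =>
    (hasDerivAt_integral_of_continuousOn_ordConnected hDopen hDconn
      (hV.div hdU.continuousOn hU') hz₀ (hΦD τ)).comp τ (hΦ1 τ)
  set g : ℝ → ℝ := fun τ => deriv U (Φ τ) * deriv Φ τ *
    Real.exp (-∫ z in z₀..Φ τ, V z / deriv U z) with hg
  have hgeq : ∀ τ, deriv (U ∘ Φ) τ / F₀ (Φ τ) = g τ := fun τ => by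
    rw [hS, hF₀ _ (hΦD τ), hg, div_eq_mul_inv, ← Real.exp_neg]
  have hg' : ∀ τ, HasDerivAt g
      (-(((V (Φ τ) - deriv (deriv U) (Φ τ)) * (deriv Φ τ) ^ 2
        - deriv U (Φ τ) * deriv (deriv Φ) τ) *
        Real.exp (-∫ z in z₀..Φ τ, V z / deriv U z))) τ := fun τ => by
    have h := (((hU2 _ (hΦD τ)).comp τ (hΦ1 τ)).mul (hΦ2 τ)).mul (hI τ).neg.exp
    refine h.congr_deriv ?_
    have hne := hU' _ (hΦD τ)
    simp only [Function.comp_apply, Pi.mul_apply, Pi.neg_apply]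
    field_simp
    ring
  have hanti : Antitone g := antitone_of_hasDerivAt_nonpos hg' fun τ =>
    neg_nonpos.2 (mul_nonneg (hNEC τ) (Real.exp_pos _).le)
  intro τ
  have h0 : 0 ≤ g τ := hanti.le_of_tendsto (by simpa only [hgeq] using hlate) τ
  rw [hS]
  exact nonneg_of_mul_nonneg_left h0 (Real.exp_pos _)
end

section
/- Second law for the standard parametrization U(Φ) = Φ (Corollary 1): Suppose D = ℝ (or an open interval), V : D → ℝ is continuous, Φ : ℝ → D is C², the null energy condition T(τ) := V(Φ(τ))·Φ'(τ)² − Φ''(τ) ≥ 0 holds for all τ ∈ ℝ, and for a fixed base point z₀ ∈ D one has exp(−∫_{z₀}^{Φ(τ)} V(z) dz)·Φ'(τ) → 0 as τ → +∞. Then Φ'(τ) ≥ 0 for all τ ∈ ℝ, i.e. the entropy S = Φ is nondecreasing. -/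
/-- The fundamental theorem of calculus for a function continuous on an open order-connected set. -/
lemma hasDerivAt_integral_of_isOpen_ordConnected {D : Set ℝ} (hDopen : IsOpen D)
    (hDconn : D.OrdConnected) {V : ℝ → ℝ} (hV : ContinuousOn V D) {z₀ x : ℝ}
    (hz₀ : z₀ ∈ D) (hx : x ∈ D) :
    HasDerivAt (fun y => ∫ z in z₀..y, V z) (V x) x :=
  intervalIntegral.integral_hasDerivAt_right
    (hV.mono (hDconn.uIcc_subset hz₀ hx)).intervalIntegrable
    (hV.stronglyMeasurableAtFilter hDopen x hx)
    (hV.continuousAt (hDopen.mem_nhds hx))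

/-- **Corollary 1** (second law for the standard parametrization `U(Φ) = Φ`).
`D ⊆ ℝ` is an open interval, `V : D → ℝ` is continuous, `Φ : ℝ → D` is `C²`.
If the null energy condition `0 ≤ V(Φ τ)·Φ'(τ)² - Φ''(τ)` holds for all `τ`
and `exp(-∫_{z₀}^{Φ τ} V(z) dz)·Φ'(τ) → 0` as `τ → ∞` for a fixed base point
`z₀ ∈ D`, then `Φ'(τ) ≥ 0` for all `τ`, i.e. the entropy `S = Φ` is
nondecreasing. -/
theorem second_law_U_eq_id
    (D : Set ℝ) (hDopen : IsOpen D) (hDconn : D.OrdConnected)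
    (V Φ : ℝ → ℝ)
    (hV : ContinuousOn V D)
    (hΦD : ∀ τ : ℝ, Φ τ ∈ D) (hΦ : ContDiff ℝ 2 Φ)
    (hNEC : ∀ τ : ℝ, 0 ≤ V (Φ τ) * (deriv Φ τ) ^ 2 - deriv (deriv Φ) τ)
    (z₀ : ℝ) (hz₀ : z₀ ∈ D)
    (hlate : Filter.Tendsto
      (fun τ => Real.exp (-∫ z in z₀..Φ τ, V z) * deriv Φ τ)
      Filter.atTop (nhds 0)) :
    ∀ τ : ℝ, 0 ≤ deriv Φ τ := by
  have hΦ' : ∀ τ, HasDerivAt Φ (deriv Φ τ) τ := fun τ =>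
    (hΦ.differentiable (by norm_num) τ).hasDerivAt
  have hΦ'' : ∀ τ, HasDerivAt (deriv Φ) (deriv (deriv Φ) τ) τ := fun τ =>
    ((ContDiff.deriv' (n := 1) hΦ).differentiable (by norm_num) τ).hasDerivAt
  have hderiv : ∀ τ, HasDerivAt (fun τ => Real.exp (-∫ z in z₀..Φ τ, V z) * deriv Φ τ)
      (-(Real.exp (-∫ z in z₀..Φ τ, V z) *
        (V (Φ τ) * (deriv Φ τ) ^ 2 - deriv (deriv Φ) τ))) τ := by
    intro τ
    have hI : HasDerivAt (fun τ => ∫ z in z₀..Φ τ, V z) (V (Φ τ) * deriv Φ τ) τ :=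
      (hasDerivAt_integral_of_isOpen_ordConnected hDopen hDconn hV hz₀ (hΦD τ)).comp τ (hΦ' τ)
    exact (hI.fun_neg.exp.fun_mul (hΦ'' τ)).congr_deriv (by ring)
  have hanti : Antitone fun τ => Real.exp (-∫ z in z₀..Φ τ, V z) * deriv Φ τ :=
    antitone_of_hasDerivAt_nonpos hderiv fun τ =>
      neg_nonpos.mpr (mul_nonneg (Real.exp_pos _).le (hNEC τ))
  intro τ
  exact nonneg_of_mul_nonneg_right (hanti.le_of_tendsto hlate τ) (Real.exp_pos _)
end

section
/- Generalized Proposition 3 with modified weight F_P: Suppose U : D → ℝ is C² with U'(z) ≠ 0 for all z ∈ D, V : D → ℝ is continuous, P : D → ℝ is continuous with P(z) ≥ 0 for all z ∈ D, Φ : ℝ → D is C², the null energy condition T(τ) := (V(Φ(τ)) − U''(Φ(τ)))·Φ'(τ)² − U'(Φ(τ))·Φ''(τ) ≥ 0 holds for all τ ∈ ℝ, and the late-time condition S'(τ)/F_P(Φ(τ)) → 0 as τ → +∞ holds, where S := U ∘ Φ. Then S'(τ) ≥ 0 for all τ ∈ ℝ. -/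
/-- The fundamental theorem of calculus for a function continuous on an open interval. -/
theorem ContinuousOn.hasDerivAt_integral_of_ordConnected {D : Set ℝ} (hDo : IsOpen D)
    (hDc : D.OrdConnected) {f : ℝ → ℝ} (hf : ContinuousOn f D) {a b : ℝ} (ha : a ∈ D)
    (hb : b ∈ D) : HasDerivAt (fun x => ∫ z in a..x, f z) (f b) b :=
  intervalIntegral.integral_hasDerivAt_right
    ((hf.mono (hDc.uIcc_subset ha hb)).intervalIntegrable)
    (hf.stronglyMeasurableAtFilter hDo b hb) (hf.continuousAt (hDo.mem_nhds hb))

/-- The derivative of a function that is twice continuously differentiable near a point is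
differentiable at that point. -/
theorem ContDiffAt.differentiableAt_deriv_of_two {f : ℝ → ℝ} {x : ℝ} (hf : ContDiffAt ℝ 2 f x) :
    DifferentiableAt ℝ (deriv f) x := by
  have h : ContDiffAt ℝ 1 (fderiv ℝ f) x := hf.fderiv_right (by norm_num)
  exact (h.differentiableAt (by norm_num)).clm_apply (differentiableAt_const (1 : ℝ))

/-- **Generalized Proposition 3** with the modified weight `F_P`.
`D ⊆ ℝ` is an open interval, `U : D → ℝ` is `C²` with `U' ≠ 0` on `D`,
`V : D → ℝ` is continuous, `P : D → ℝ` is continuous and nonnegative,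
`Φ : ℝ → D` is `C²`.  With
`F_P(Z) := exp (∫_{z₀}^{Z} (V(z)+P(z))/U'(z) dz)` for a fixed `z₀ ∈ D`,
if the null energy condition holds and `S'(τ)/F_P(Φ(τ)) → 0` as `τ → ∞`
for the entropy `S := U ∘ Φ`, then `S'(τ) ≥ 0` for all `τ`. -/
theorem second_law_weight_FP
    (D : Set ℝ) (hDopen : IsOpen D) (hDconn : D.OrdConnected)
    (U V P Φ : ℝ → ℝ)
    (hU : ContDiffOn ℝ 2 U D) (hU' : ∀ z ∈ D, deriv U z ≠ 0)
    (hV : ContinuousOn V D)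
    (hP : ContinuousOn P D) (hPpos : ∀ z ∈ D, 0 ≤ P z)
    (hΦD : ∀ τ : ℝ, Φ τ ∈ D) (hΦ : ContDiff ℝ 2 Φ)
    (hNEC : ∀ τ : ℝ,
      0 ≤ (V (Φ τ) - deriv (deriv U) (Φ τ)) * (deriv Φ τ) ^ 2
            - deriv U (Φ τ) * deriv (deriv Φ) τ)
    (z₀ : ℝ) (hz₀ : z₀ ∈ D)
    (FP : ℝ → ℝ)
    (hFP : ∀ Z ∈ D, FP Z = Real.exp (∫ z in z₀..Z, (V z + P z) / deriv U z))
    (hlate : Filter.Tendsto (fun τ => deriv (U ∘ Φ) τ / FP (Φ τ))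
      Filter.atTop (nhds 0)) :
    ∀ τ : ℝ, 0 ≤ deriv (U ∘ Φ) τ := by
  have hUat (z : ℝ) (hz : z ∈ D) : ContDiffAt ℝ 2 U z := hU.contDiffAt (hDopen.mem_nhds hz)
  have hU1 (z : ℝ) (hz : z ∈ D) : HasDerivAt U (deriv U z) z :=
    ((hUat z hz).differentiableAt (by norm_num)).hasDerivAt
  have hU2 (z : ℝ) (hz : z ∈ D) : HasDerivAt (deriv U) (deriv (deriv U) z) z :=
    (hUat z hz).differentiableAt_deriv_of_two.hasDerivAt
  have hΦ1 (τ : ℝ) : HasDerivAt Φ (deriv Φ τ) τ :=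
    (hΦ.contDiffAt.differentiableAt (by norm_num)).hasDerivAt
  have hΦ2 (τ : ℝ) : HasDerivAt (deriv Φ) (deriv (deriv Φ) τ) τ :=
    hΦ.contDiffAt.differentiableAt_deriv_of_two.hasDerivAt
  have hcont : ContinuousOn (fun z => (V z + P z) / deriv U z) D :=
    (hV.add hP).div (fun z hz => (hU2 z hz).continuousAt.continuousWithinAt) hU'
  have hS (τ : ℝ) : deriv (U ∘ Φ) τ = deriv U (Φ τ) * deriv Φ τ :=
    ((hU1 _ (hΦD τ)).comp τ (hΦ1 τ)).deriv
  set W : ℝ → ℝ := fun Z => ∫ z in z₀..Z, (V z + P z) / deriv U z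
  have hW1 (τ : ℝ) : HasDerivAt (fun t => W (Φ t))
      ((V (Φ τ) + P (Φ τ)) / deriv U (Φ τ) * deriv Φ τ) τ :=
    (hcont.hasDerivAt_integral_of_ordConnected hDopen hDconn hz₀ (hΦD τ)).comp τ (hΦ1 τ)
  have hg : (fun τ => deriv (U ∘ Φ) τ / FP (Φ τ)) =
      fun τ => deriv U (Φ τ) * deriv Φ τ * Real.exp (-W (Φ τ)) := by
    funext τ
    rw [hS, hFP _ (hΦD τ), Real.exp_neg, div_eq_mul_inv]
  have hderiv (τ : ℝ) : HasDerivAt (fun τ => deriv (U ∘ Φ) τ / FP (Φ τ))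
      (-(((V (Φ τ) - deriv (deriv U) (Φ τ)) * (deriv Φ τ) ^ 2
        - deriv U (Φ τ) * deriv (deriv Φ) τ + P (Φ τ) * (deriv Φ τ) ^ 2)
        * Real.exp (-W (Φ τ)))) τ := by
    rw [hg]
    refine HasDerivAt.congr_deriv
      ((((hU2 _ (hΦD τ)).comp τ (hΦ1 τ)).mul (hΦ2 τ)).mul (hW1 τ).neg.exp) ?_
    have hne := hU' _ (hΦD τ)
    simp only [Function.comp_apply, Pi.mul_apply, Pi.neg_apply]
    field_simp
    ring
  have hanti : Antitone (fun τ => deriv (U ∘ Φ) τ / FP (Φ τ)) := by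
    refine antitone_of_hasDerivAt_nonpos hderiv fun τ => neg_nonpos.mpr ?_
    exact mul_nonneg (add_nonneg (hNEC τ) (mul_nonneg (hPpos _ (hΦD τ)) (sq_nonneg _)))
      (Real.exp_pos _).le
  intro τ
  have hpos : 0 < FP (Φ τ) := by
    rw [hFP _ (hΦD τ)]
    exact Real.exp_pos _
  have hnonneg : 0 ≤ deriv (U ∘ Φ) τ / FP (Φ τ) := hanti.le_of_tendsto hlate τ
  exact (div_nonneg_iff.mp hnonneg).elim And.left fun h => absurd h.2 hpos.not_ge
end

section
/- Second law for f(R)-theories (Theorem 2): Let S : ℝ → ℝ be C² and T : ℝ → ℝ satisfy T(τ) ≥ 0 and S''(τ) = −T(τ) for all τ ∈ ℝ. Let H : ℝ → ℝ be C² with H'(s) > 0 and H''(s) ≤ 0 for all s ∈ ℝ (a strictly monotonically increasing function with nonpositive second derivative). If (H ∘ S)'(τ) → 0 as τ → +∞, then S'(τ) ≥ 0 for all τ ∈ ℝ. In particular (taking H = id), if S'(τ) → 0 as τ → +∞ then S'(τ) ≥ 0 for all τ. -/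
/-- The derivative of a `C²` function with nonpositive second derivative is antitone. -/
theorem antitone_deriv_of_contDiff_two {f : ℝ → ℝ} (hf : ContDiff ℝ 2 f)
    (hf'' : ∀ x : ℝ, deriv (deriv f) x ≤ 0) : Antitone (deriv f) := by
  have h : ContDiff ℝ 1 (deriv f) := ContDiff.deriv' (n := 1) (by simpa [one_add_one_eq_two] using hf)
  exact antitone_of_deriv_nonpos (h.differentiable one_ne_zero) hf''

/-- **Theorem 2** (second law for `f(R)`-theories).
Let `S : ℝ → ℝ` be `C²` (the entropy `S = f'(R)` along the horizon) and
`T : ℝ → ℝ` with `T ≥ 0` and `S'' = -T` (the null energy condition).  Let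
`H : ℝ → ℝ` be `C²`, strictly monotonically increasing (`H' > 0`) with
nonpositive second derivative (`H'' ≤ 0`).  If `(H ∘ S)'(τ) → 0` as
`τ → ∞`, then `S'(τ) ≥ 0` for all `τ`. -/
theorem second_law_fR
    (S T H : ℝ → ℝ)
    (hS : ContDiff ℝ 2 S)
    (hT : ∀ τ : ℝ, 0 ≤ T τ)
    (heq : ∀ τ : ℝ, deriv (deriv S) τ = -T τ)
    (hH : ContDiff ℝ 2 H)
    (hH' : ∀ s : ℝ, 0 < deriv H s)
    (hH'' : ∀ s : ℝ, deriv (deriv H) s ≤ 0)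
    (hlate : Filter.Tendsto (deriv (H ∘ S)) Filter.atTop (nhds 0)) :
    ∀ τ : ℝ, 0 ≤ deriv S τ := by
  have hSd : Differentiable ℝ S := hS.differentiable two_ne_zero
  have hHd : Differentiable ℝ H := hH.differentiable two_ne_zero
  have hSanti : Antitone (deriv S) :=
    antitone_deriv_of_contDiff_two hS fun τ => by linarith [heq τ, hT τ]
  have hHanti : Antitone (deriv H) := antitone_deriv_of_contDiff_two hH hH''
  intro τ₀
  by_contra! hneg
  have hSdecr : AntitoneOn S (Set.Ici τ₀) := by
    refine antitoneOn_of_deriv_nonpos (convex_Ici τ₀) hSd.continuous.continuousOn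
      hSd.differentiableOn fun τ hτ => ?_
    exact (hSanti (interior_subset hτ)).trans hneg.le
  have hbound : ∀ τ ≥ τ₀, deriv (H ∘ S) τ ≤ deriv H (S τ₀) * deriv S τ₀ := by
    intro τ hτ
    rw [deriv_comp τ (hHd _) (hSd _)]
    have hSτ : S τ ≤ S τ₀ := hSdecr Set.self_mem_Ici hτ hτ
    calc deriv H (S τ) * deriv S τ
        ≤ deriv H (S τ) * deriv S τ₀ :=
          mul_le_mul_of_nonneg_left (hSanti hτ) (hH' _).le
      _ ≤ deriv H (S τ₀) * deriv S τ₀ :=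
          mul_le_mul_of_nonpos_right (hHanti hSτ) hneg.le
  have hlim : 0 ≤ deriv H (S τ₀) * deriv S τ₀ :=
    le_of_tendsto hlate (Filter.eventually_atTop.2 ⟨τ₀, hbound⟩)
  exact hlim.not_gt (mul_neg_of_pos_of_neg (hH' _) hneg)
end

section
/- Concavity of the entropy in the conformal affine parameter (Eq. (2hs)): Suppose U : D → ℝ is C² with U'(z) ≠ 0 for all z ∈ D, V : D → ℝ is continuous, Φ : ℝ → D is C², and T : ℝ → ℝ satisfies the master equation T(τ) = (V(Φ(τ)) − U''(Φ(τ)))·Φ'(τ)² − U'(Φ(τ))·Φ''(τ) for all τ. Define σ : ℝ → ℝ by σ(τ) := ∫_0^τ F₀(Φ(λ)) dλ, where F₀(Z) := exp(∫_{z₀}^{Z} V(z)/U'(z) dz) for a fixed z₀ ∈ D. Then σ is strictly increasing and C², and the function S̃ := (U ∘ Φ) ∘ σ⁻¹ on the image of σ is twice differentiable with S̃''(σ(τ)) = −T(τ)/F₀(Φ(τ))² for all τ; in particular, if T(τ) ≥ 0 for all τ then S̃ is concave. -/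
/-- If `u` has derivative `u'`, then reading `u` in the coordinate given by an open embedding `σ`
with derivative `f ≠ 0` divides its derivative by `f`. -/
theorem hasDerivAt_comp_toOpenPartialHomeomorph_symm {σ u : ℝ → ℝ} {f u' τ : ℝ}
    (hσ : Topology.IsOpenEmbedding σ) (hd : HasDerivAt σ f τ) (hf : f ≠ 0)
    (hu : HasDerivAt u u' τ) :
    HasDerivAt (fun y => u ((hσ.toOpenPartialHomeomorph σ).symm y)) (u' / f) (σ τ) := by
  have hinv : (hσ.toOpenPartialHomeomorph σ).symm (σ τ) = τ :=
    hσ.toOpenPartialHomeomorph_left_inv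
  have h1 : HasDerivAt (hσ.toOpenPartialHomeomorph σ).symm f⁻¹ (σ τ) :=
    (hσ.toOpenPartialHomeomorph σ).hasDerivAt_symm (by simp) hf (by rw [hinv]; exact hd)
  rw [div_eq_mul_inv]
  exact HasDerivAt.comp (σ τ) (by rw [hinv]; exact hu) h1

/-- The exponential of a primitive of a continuous function `g` on an interval solves
`F' = F * g`. -/
theorem hasDerivAt_exp_integral {D : Set ℝ} (hDopen : IsOpen D) (hDconn : D.OrdConnected)
    {g F : ℝ → ℝ} (hg : ContinuousOn g D) {a : ℝ} (ha : a ∈ D)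
    (hF : ∀ x ∈ D, F x = Real.exp (∫ z in a..x, g z)) {x : ℝ} (hx : x ∈ D) :
    HasDerivAt F (F x * g x) x := by
  have h := intervalIntegral.integral_hasDerivAt_right
    ((hg.mono (hDconn.uIcc_subset ha hx)).intervalIntegrable (μ := MeasureTheory.volume))
    (hg.stronglyMeasurableAtFilter hDopen x hx) (hg.continuousAt (hDopen.mem_nhds hx))
  have h2 := h.exp
  rw [← hF x hx] at h2
  exact h2.congr_of_eventuallyEq (Filter.eventually_of_mem (hDopen.mem_nhds hx) hF)


/-- **Eq. (2hs)**: concavity of the entropy in the conformal affine parameter.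
`D ⊆ ℝ` is an open interval, `U : D → ℝ` is `C²` with `U' ≠ 0` on `D`,
`V : D → ℝ` is continuous, `Φ : ℝ → D` is `C²`, and `T` satisfies the master
equation.  With `F₀(Z) := exp (∫_{z₀}^{Z} V(z)/U'(z) dz)` for a fixed
`z₀ ∈ D`, set `σ(τ) := ∫_0^τ F₀(Φ(λ)) dλ` (so `τ̃ = σ(τ)` is the affine
parameter of the conformally rescaled metric).  Then `σ` is strictly
increasing and `C²`, and the entropy expressed as a function `S̃` of `τ̃`
(i.e. `S̃(σ(τ)) = U(Φ(τ))`) is twice differentiable with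
`S̃''(σ(τ)) = -T(τ)/F₀(Φ(τ))²`; in particular, if `T ≥ 0` then `S̃` is concave
on the range of `σ`. -/
theorem entropy_concave_in_conformal_parameter
    (D : Set ℝ) (hDopen : IsOpen D) (hDconn : D.OrdConnected)
    (U V Φ T : ℝ → ℝ)
    (hU : ContDiffOn ℝ 2 U D) (hU' : ∀ z ∈ D, deriv U z ≠ 0)
    (hV : ContinuousOn V D)
    (hΦD : ∀ τ : ℝ, Φ τ ∈ D) (hΦ : ContDiff ℝ 2 Φ)
    (hmaster : ∀ τ : ℝ,
      T τ = (V (Φ τ) - deriv (deriv U) (Φ τ)) * (deriv Φ τ) ^ 2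
              - deriv U (Φ τ) * deriv (deriv Φ) τ)
    (z₀ : ℝ) (hz₀ : z₀ ∈ D)
    (F₀ : ℝ → ℝ) (hF₀ : ∀ Z ∈ D, F₀ Z = Real.exp (∫ z in z₀..Z, V z / deriv U z))
    (σ : ℝ → ℝ) (hσ : ∀ τ : ℝ, σ τ = ∫ l in (0:ℝ)..τ, F₀ (Φ l)) :
    StrictMono σ ∧ ContDiff ℝ 2 σ ∧
    ∃ Stilde : ℝ → ℝ,
      (∀ τ : ℝ, Stilde (σ τ) = U (Φ τ)) ∧
      ContDiffOn ℝ 2 Stilde (Set.range σ) ∧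
      (∀ τ : ℝ, deriv (deriv Stilde) (σ τ) = -T τ / (F₀ (Φ τ)) ^ 2) ∧
      ((∀ τ : ℝ, 0 ≤ T τ) → ConcaveOn ℝ (Set.range σ) Stilde) := by
  have hU1 : ContDiffOn ℝ 1 (deriv U) D := hU.deriv_of_isOpen hDopen (by norm_num)
  have hdU : ∀ z ∈ D, HasDerivAt U (deriv U z) z := fun z hz =>
    ((hU.differentiableOn (by norm_num)).differentiableAt (hDopen.mem_nhds hz)).hasDerivAt
  have hddU : ∀ z ∈ D, HasDerivAt (deriv U) (deriv (deriv U) z) z := fun z hz =>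
    ((hU1.differentiableOn (by norm_num)).differentiableAt (hDopen.mem_nhds hz)).hasDerivAt
  have hΦ1 : ContDiff ℝ 1 (deriv Φ) := hΦ.deriv'
  have hdΦ : ∀ τ, HasDerivAt Φ (deriv Φ τ) τ := fun τ =>
    (hΦ.differentiable (by norm_num) τ).hasDerivAt
  have hddΦ : ∀ τ, HasDerivAt (deriv Φ) (deriv (deriv Φ) τ) τ := fun τ =>
    (hΦ1.differentiable (by norm_num) τ).hasDerivAt
  have hg : ContinuousOn (fun z => V z / deriv U z) D := hV.div hU1.continuousOn hU'
  set f : ℝ → ℝ := fun τ => F₀ (Φ τ) with hf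
  have hfpos : ∀ τ, 0 < f τ := fun τ => by
    simp only [hf, hF₀ _ (hΦD τ)]
    exact Real.exp_pos _
  have hfne : ∀ τ, f τ ≠ 0 := fun τ => (hfpos τ).ne'
  have hdf : ∀ τ, HasDerivAt f (f τ * (V (Φ τ) / deriv U (Φ τ)) * deriv Φ τ) τ := fun τ =>
    (hasDerivAt_exp_integral hDopen hDconn hg hz₀ hF₀ (hΦD τ)).comp τ (hdΦ τ)
  have hfc : Continuous f := continuous_iff_continuousAt.2 fun τ => (hdf τ).continuousAt
  have hf1 : ContDiff ℝ 1 f := by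
    refine contDiff_one_iff_deriv.2 ⟨fun τ => (hdf τ).differentiableAt, ?_⟩
    rw [funext fun τ => (hdf τ).deriv]
    exact (hfc.mul (hg.comp_continuous hΦ.continuous hΦD)).mul hΦ1.continuous
  have hdσ : ∀ τ, HasDerivAt σ (f τ) τ := fun τ => by
    rw [funext hσ]
    exact hfc.integral_hasStrictDerivAt 0 τ |>.hasDerivAt
  have hderivσ : deriv σ = f := funext fun τ => (hdσ τ).deriv
  have hmono : StrictMono σ := strictMono_of_deriv_pos fun τ => by
    rw [hderivσ]
    exact hfpos τ
  have hσ2 : ContDiff ℝ 2 σ := by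
    rw [show (2 : WithTop ℕ∞) = 1 + 1 by norm_num, contDiff_succ_iff_deriv, hderivσ]
    exact ⟨fun τ => (hdσ τ).differentiableAt, by simp, hf1⟩
  have hσc : Continuous σ := hσ2.continuous
  have hemb : Topology.IsOpenEmbedding σ :=
    .of_continuous_injective_isOpenMap hσc hmono.injective <|
      isOpenMap_of_hasStrictDerivAt
        (fun τ => hσ2.contDiffAt.hasStrictDerivAt' (hdσ τ) (by norm_num)) hfne
  have hinv : ∀ τ, (hemb.toOpenPartialHomeomorph σ).symm (σ τ) = τ := fun τ =>
    hemb.toOpenPartialHomeomorph_left_inv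
  set S : ℝ → ℝ := fun y => U (Φ ((hemb.toOpenPartialHomeomorph σ).symm y)) with hS
  have hS2 : ContDiffOn ℝ 2 S (Set.range σ) := by
    rintro _ ⟨τ, rfl⟩
    have hUΦ : ContDiff ℝ 2 (fun τ => U (Φ τ)) := hU.comp_contDiff hΦ hΦD
    have hsymm : ContDiffAt ℝ 2 (hemb.toOpenPartialHomeomorph σ).symm (σ τ) :=
      (hemb.toOpenPartialHomeomorph σ).contDiffAt_symm_deriv (hfne τ) (by simp)
        (by rw [hinv]; exact hdσ τ) hσ2.contDiffAt
    exact (hUΦ.contDiffAt.comp (σ τ) hsymm).contDiffWithinAt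
  have hdS : ∀ τ, deriv S (σ τ) = deriv U (Φ τ) * deriv Φ τ / f τ := fun τ =>
    (hasDerivAt_comp_toOpenPartialHomeomorph_symm hemb (hdσ τ) (hfne τ)
      ((hdU _ (hΦD τ)).comp τ (hdΦ τ))).deriv
  have hddS : ∀ τ, deriv (deriv S) (σ τ) = -T τ / (f τ) ^ 2 := fun τ => by
    have heq : deriv S =ᶠ[nhds (σ τ)] fun y =>
        (fun t => deriv U (Φ t) * deriv Φ t / f t)
          ((hemb.toOpenPartialHomeomorph σ).symm y) := by
      filter_upwards [hemb.isOpen_range.mem_nhds ⟨τ, rfl⟩]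
      rintro _ ⟨t, rfl⟩
      simp only [hdS, hinv]
    have hquot : HasDerivAt (fun t => deriv U (Φ t) * deriv Φ t / f t) _ τ :=
      (((hddU _ (hΦD τ)).comp τ (hdΦ τ)).mul (hddΦ τ)).div (hdf τ) (hfne τ)
    rw [heq.deriv_eq, (hasDerivAt_comp_toOpenPartialHomeomorph_symm hemb (hdσ τ) (hfne τ)
      hquot).deriv, hmaster]
    have h1 := hfne τ
    have h2 := hU' _ (hΦD τ)
    simp only [Function.comp_apply, Pi.mul_apply]
    field_simp
    ring
  refine ⟨hmono, hσ2, S, fun τ => by simp only [hS, hinv], hS2, hddS, fun hT => ?_⟩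
  have hopen := hemb.isOpen_range
  refine concaveOn_of_deriv2_nonpos (isPreconnected_range hσc).ordConnected.convex
    hS2.continuousOn ?_ ?_ ?_
  · rw [hopen.interior_eq]
    exact hS2.differentiableOn (by norm_num)
  · rw [hopen.interior_eq]
    exact (hS2.deriv_of_isOpen (m := 1) hopen (by norm_num)).differentiableOn (by norm_num)
  · rw [hopen.interior_eq]
    rintro _ ⟨τ, rfl⟩
    change deriv (deriv S) (σ τ) ≤ 0
    rw [hddS]
    exact div_nonpos_of_nonpos_of_nonneg (neg_nonpos.2 (hT τ)) (sq_nonneg _)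
end
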